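/- arXiv:2209.05147 — 3 statements merged into one kernel-verified Lean document; each statement's English description precedes it below -/
import Mathlib

section
/- For all integers k ≥ 2 and r ≥ 3, the smallest minimum degree of an r-Ramsey minimal graph for the complete graph K_{k+1} satisfies s_r(K_{k+1}) ≤ (8·k·r·ln k)^3. -/
/-- `G → (K_n)_r`: every `r`-colouring of the edges of `G` contains a
monochromatic copy of the complete graph on `n` vertices. -/
def IsRamsey {V : Type*} (G : SimpleGraph V) (r n : ℕ) : Prop :=
  ∀ c : Sym2 V → Fin r, ∃ (i : Fin r) (S : Finset V), S.card = n ∧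
    ∀ x ∈ S, ∀ y ∈ S, x ≠ y → G.Adj x y ∧ c s(x, y) = i

/-- `G` is `r`-Ramsey minimal for `K_n`: `G → (K_n)_r` but no proper subgraph
of `G` is `r`-Ramsey for `K_n`. -/
def IsRamseyMinimal {V : Type*} (G : SimpleGraph V) (r n : ℕ) : Prop :=
  IsRamsey G r n ∧ ∀ G' : G.Subgraph, G' ≠ ⊤ → ¬ IsRamsey G'.coe r n

/-- The minimum degree of a finite graph. -/
noncomputable def minDeg {V : Type*} [Fintype V] (G : SimpleGraph V) : ℕ :=
  @SimpleGraph.minDegree V G _ (Classical.decRel _)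


theorem exists_min_determined_coloring (K : Type) [Finite K] (L : ℕ) :
    ∃ R : ℕ, ∀ {α : Type} [LinearOrder α] (κ : α → α → K) (S : Finset α), R ≤ S.card →
      ∃ T ⊆ S, T.card = L ∧ ∃ g : α → K, ∀ x ∈ T, ∀ y ∈ T, x < y → κ x y = g x := by
  classical
  have := Fintype.ofFinite K
  induction L with
  | zero =>
    rcases isEmpty_or_nonempty K with hK | hK
    · refine ⟨1, fun κ S hS => ?_⟩
      obtain ⟨x, -⟩ := Finset.card_pos.mp hS
      exact hK.elim (κ x x)
    · exact ⟨0, fun κ S _ => ⟨∅, by simp, rfl, fun _ => hK.some, by simp⟩⟩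
  | succ L ih =>
    obtain ⟨R, hR⟩ := ih
    refine ⟨Fintype.card K * R + 1, fun {α} _ κ S hS => ?_⟩
    have hne : S.Nonempty := Finset.card_pos.mp (by omega)
    set s := S.min' hne
    have hs : s ∈ S := S.min'_mem hne
    have : Nonempty K := ⟨κ s s⟩
    obtain ⟨d, -, hd⟩ := Finset.exists_le_card_fiber_of_mul_le_card_of_maps_to
      (s := S.erase s) (t := Finset.univ) (f := κ s) (n := R) (fun _ _ => Finset.mem_univ _)
      Finset.univ_nonempty (by rw [Finset.card_erase_of_mem hs, Finset.card_univ]; omega)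
    obtain ⟨T, hTS, hTc, g, hg⟩ := hR κ _ hd
    have hT : ∀ x ∈ T, x ∈ S ∧ s < x ∧ κ s x = d := by
      intro x hx
      have h := hTS hx
      simp only [Finset.mem_filter, Finset.mem_erase] at h
      exact ⟨h.1.2, lt_of_le_of_ne (S.min'_le x h.1.2) (Ne.symm h.1.1), h.2⟩
    have hsT : s ∉ T := fun h => lt_irrefl _ (hT s h).2.1
    refine ⟨insert s T, ?_, by rw [Finset.card_insert_of_notMem hsT, hTc],
      Function.update g s d, ?_⟩
    · intro x hx
      rcases Finset.mem_insert.mp hx with rfl | hx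
      · exact hs
      · exact (hT x hx).1
    · intro x hx y hy hxy
      rcases Finset.mem_insert.mp hx with rfl | hx
      · rcases Finset.mem_insert.mp hy with rfl | hy
        · exact absurd hxy (lt_irrefl _)
        · simpa using (hT y hy).2.2
      · have hxs : x ≠ s := (hT x hx).2.1.ne'
        rcases Finset.mem_insert.mp hy with rfl | hy
        · exact absurd hxy (hT x hx).2.1.not_gt
        · simpa [hxs] using hg x hx y hy hxy

/-- Ramsey's theorem for graphs and finitely many colours. -/
theorem exists_monochromatic_subset (K : Type) [Finite K] (n : ℕ) :
    ∃ R : ℕ, ∀ κ : Fin R → Fin R → K,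
      ∃ h : Fin n → Fin R, StrictMono h ∧ ∃ d, ∀ p q, p < q → κ (h p) (h q) = d := by
  classical
  have := Fintype.ofFinite K
  obtain ⟨R, hR⟩ := exists_min_determined_coloring K (Fintype.card K * n + 1)
  refine ⟨R, fun κ => ?_⟩
  obtain ⟨T, -, hTc, g, hg⟩ := hR κ Finset.univ (by simp)
  obtain ⟨x, -⟩ : T.Nonempty := Finset.card_pos.mp (by omega)
  have : Nonempty K := ⟨κ x x⟩
  obtain ⟨d, -, hd⟩ := Finset.exists_le_card_fiber_of_mul_le_card_of_maps_to
    (s := T) (t := Finset.univ) (f := g) (n := n) (fun _ _ => Finset.mem_univ _)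
    Finset.univ_nonempty (by rw [Finset.card_univ]; omega)
  obtain ⟨U, hU, hUc⟩ := Finset.exists_subset_card_eq hd
  refine ⟨U.orderEmbOfFin hUc, (U.orderEmbOfFin hUc).strictMono, d, fun p q hpq => ?_⟩
  have hp := Finset.mem_filter.mp (hU (U.orderEmbOfFin_mem hUc p))
  have hq := Finset.mem_filter.mp (hU (U.orderEmbOfFin_mem hUc q))
  rw [hg _ hp.1 _ hq.1 ((U.orderEmbOfFin hUc).strictMono hpq), hp.2]

/-- A graph whose edge set is partitioned into `r` colour classes. -/
structure ColoredGraph (r : ℕ) (V : Type) where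
  Adj : Fin r → V → V → Prop
  symm : ∀ {i x y}, Adj i x y → Adj i y x
  irrefl : ∀ {i x}, ¬ Adj i x x
  eq_of_adj : ∀ {i j x y}, Adj i x y → Adj j x y → i = j

namespace ColoredGraph

variable {r : ℕ} {V W A : Type}

/-- No colour class contains a complete graph on `m` vertices. -/
def MonoCliqueFree (X : ColoredGraph r V) (m : ℕ) : Prop :=
  ∀ (i : Fin r) (f : Fin m → V), ¬ ∀ p q, p ≠ q → X.Adj i (f p) (f q)

/-- The fibres of `π` contain no edges. -/
def IsPartite (X : ColoredGraph r V) (π : V → A) : Prop :=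
  ∀ i x y, X.Adj i x y → π x ≠ π y

/-- A map that preserves adjacency in every colour. -/
def IsHom (X : ColoredGraph r V) (Y : ColoredGraph r W) (φ : V → W) : Prop :=
  ∀ l x y, X.Adj l x y → Y.Adj l (φ x) (φ y)

/-- The edges of colour `i` from the part `a` to the part `b`. -/
abbrev PartEdge (X : ColoredGraph r V) (π : V → A) (a b : A) (i : Fin r) : Type :=
  {e : V × V // π e.1 = a ∧ π e.2 = b ∧ X.Adj i e.1 e.2}

section Amalgam

open Classical in
/-- The copy of the vertex set `V` along a combinatorial line, where copies along different lines
share vertices in the parts `a` and `b` only. -/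
noncomputable def lineEmb (X : ColoredGraph r V) (π : V → A) (a b : A) (i : Fin r) {ι : Type}
    (L : Combinatorics.Line (X.PartEdge π a b i) ι) (v : V) :
    (Bool × (ι → V)) ⊕ (Combinatorics.Line (X.PartEdge π a b i) ι × V) :=
  if π v = a then Sum.inl (false, fun t => ((L.idxFun t).map fun e => e.1.1).getD v)
  else if π v = b then Sum.inl (true, fun t => ((L.idxFun t).map fun e => e.1.2).getD v)
  else Sum.inr (L, v)

/-- The projection of the amalgam onto the set of parts. -/
def amalgamProj (X : ColoredGraph r V) (π : V → A) (a b : A) (i : Fin r) {ι : Type} :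
    (Bool × (ι → V)) ⊕ (Combinatorics.Line (X.PartEdge π a b i) ι × V) → A
  | Sum.inl (false, _) => a
  | Sum.inl (true, _) => b
  | Sum.inr (_, v) => π v

variable (X : ColoredGraph r V) (π : V → A) (a b : A) (i : Fin r) {ι : Type}

theorem amalgamProj_lineEmb (L : Combinatorics.Line (X.PartEdge π a b i) ι) (v : V) :
    X.amalgamProj π a b i (X.lineEmb π a b i L v) = π v := by
  unfold lineEmb
  split_ifs with h1 h2
  · exact h1.symm
  · exact h2.symm
  · rfl

variable {X π a b i}

theorem line_eq_of_lineEmb_eq {L L' : Combinatorics.Line (X.PartEdge π a b i) ι} {x x' : V}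
    (ha : π x ≠ a) (hb : π x ≠ b) (h : X.lineEmb π a b i L' x' = X.lineEmb π a b i L x) :
    L' = L := by
  have h1 := congrArg (X.amalgamProj π a b i) h
  simp only [amalgamProj_lineEmb] at h1
  simp only [lineEmb, h1, ha, hb, if_false] at h
  simp only [Sum.inr.injEq, Prod.mk.injEq] at h
  exact h.1

theorem lineEmb_injective (L : Combinatorics.Line (X.PartEdge π a b i) ι) :
    Function.Injective (X.lineEmb π a b i L) := by
  intro x x' h
  obtain ⟨t, ht⟩ := L.proper
  have h1 := congrArg (X.amalgamProj π a b i) h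
  simp only [amalgamProj_lineEmb] at h1
  by_cases ha : π x' = a
  · simp only [lineEmb, h1, ha, if_true] at h
    simpa [ht] using congrFun (congrArg Prod.snd (Sum.inl.inj h)) t
  by_cases hb : π x' = b
  · rw [hb] at ha h1
    simp only [lineEmb, h1, ha, hb, if_true, if_false] at h
    simpa [ht] using congrFun (congrArg Prod.snd (Sum.inl.inj h)) t
  · simp only [lineEmb, h1, ha, hb, if_false] at h
    exact congrArg Prod.snd (Sum.inr.inj h)

theorem adj_of_lineEmb_eq_of_mem_parts {L L' : Combinatorics.Line (X.PartEdge π a b i) ι}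
    {l : Fin r} {x y x' y' : V} (hab : a ≠ b) (hxa : π x = a) (hyb : π y = b)
    (hx : X.lineEmb π a b i L' x' = X.lineEmb π a b i L x)
    (hy : X.lineEmb π a b i L' y' = X.lineEmb π a b i L y)
    (hl : X.Adj l x' y') : X.Adj l x y := by
  have h1 := congrArg (X.amalgamProj π a b i) hx
  have h2 := congrArg (X.amalgamProj π a b i) hy
  simp only [amalgamProj_lineEmb] at h1 h2
  simp only [lineEmb, h1, hxa, if_true] at hx
  simp only [lineEmb, h2, hyb, hab.symm, if_true, if_false] at hy
  have hx := fun t => congrFun (congrArg Prod.snd (Sum.inl.inj hx)) t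
  have hy := fun t => congrFun (congrArg Prod.snd (Sum.inl.inj hy)) t
  simp only at hx hy
  obtain ⟨t, ht⟩ := L.proper
  obtain ⟨t', ht'⟩ := L'.proper
  have hxt := hx t
  have hyt := hy t
  have hxt' := hx t'
  have hyt' := hy t'
  simp only [ht, ht', Option.map_none, Option.getD_none] at hxt hyt hxt' hyt'
  cases h : L'.idxFun t with
  | none =>
    simp only [h, Option.map_none, Option.getD_none] at hxt hyt
    rwa [← hxt, ← hyt]
  | some e =>
    simp only [h, Option.map_some, Option.getD_some] at hxt hyt
    have he : X.Adj i x y := by rw [← hxt, ← hyt]; exact e.2.2.2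
    cases h' : L.idxFun t' with
    | none =>
      simp only [h', Option.map_none, Option.getD_none] at hxt' hyt'
      rwa [← hxt', ← hyt']
    | some e' =>
      simp only [h', Option.map_some, Option.getD_some] at hxt' hyt'
      have he' : X.Adj i x' y' := by rw [hxt', hyt']; exact e'.2.2.2
      rwa [X.eq_of_adj hl he']

theorem adj_of_lineEmb_eq (hπ : X.IsPartite π)
    {L L' : Combinatorics.Line (X.PartEdge π a b i) ι} {l : Fin r} {x y x' y' : V}
    (hx : X.lineEmb π a b i L' x' = X.lineEmb π a b i L x)
    (hy : X.lineEmb π a b i L' y' = X.lineEmb π a b i L y)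
    (hl : X.Adj l x' y') : X.Adj l x y := by
  by_cases hL : L' = L
  · subst hL
    rwa [← lineEmb_injective _ hx, ← lineEmb_injective _ hy]
  have h1 := congrArg (X.amalgamProj π a b i) hx
  have h2 := congrArg (X.amalgamProj π a b i) hy
  simp only [amalgamProj_lineEmb] at h1 h2
  have hne : π x ≠ π y := by rw [← h1, ← h2]; exact hπ l _ _ hl
  have hxab : π x = a ∨ π x = b := by
    by_contra! h
    exact hL (line_eq_of_lineEmb_eq h.1 h.2 hx)
  have hyab : π y = a ∨ π y = b := by
    by_contra! h
    exact hL (line_eq_of_lineEmb_eq h.1 h.2 hy)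
  rcases hxab with hxa | hxb <;> rcases hyab with hya | hyb
  · exact absurd (hxa.trans hya.symm) hne
  · exact adj_of_lineEmb_eq_of_mem_parts (hxa ▸ hyb ▸ hne) hxa hyb hx hy hl
  · exact X.symm (adj_of_lineEmb_eq_of_mem_parts (hxb ▸ hya ▸ hne.symm) hya hxb hy hx (X.symm hl))
  · exact absurd (hxb.trans hyb.symm) hne

variable (X π a b i ι) in
/-- The union of the copies of `X` along all combinatorial lines. -/
noncomputable def amalgam (hπ : X.IsPartite π) :
    ColoredGraph r ((Bool × (ι → V)) ⊕ (Combinatorics.Line (X.PartEdge π a b i) ι × V)) where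
  Adj l w w' := ∃ L x y, X.lineEmb π a b i L x = w ∧ X.lineEmb π a b i L y = w' ∧ X.Adj l x y
  symm := by
    rintro l _ _ ⟨L, x, y, rfl, rfl, h⟩
    exact ⟨L, y, x, rfl, rfl, X.symm h⟩
  irrefl := by
    rintro l _ ⟨L, x, y, rfl, h, hl⟩
    rw [lineEmb_injective L h] at hl
    exact X.irrefl hl
  eq_of_adj := by
    rintro l l' _ _ ⟨L, x, y, rfl, rfl, h⟩ ⟨L', x', y', hx, hy, h'⟩
    exact X.eq_of_adj h (adj_of_lineEmb_eq hπ hx hy h')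

theorem amalgam_isPartite (hπ : X.IsPartite π) :
    (X.amalgam π a b i ι hπ).IsPartite (X.amalgamProj π a b i) := by
  rintro l _ _ ⟨L, x, y, rfl, rfl, h⟩
  simp only [amalgamProj_lineEmb]
  exact hπ l x y h

theorem amalgam_monoCliqueFree (hπ : X.IsPartite π) {m : ℕ} (hm : 3 ≤ m)
    (hX : X.MonoCliqueFree m) : (X.amalgam π a b i ι hπ).MonoCliqueFree m := by
  intro l f hf
  set ρ : _ → A := X.amalgamProj π a b i
  have hρ : ∀ p q, p ≠ q → ρ (f p) ≠ ρ (f q) := fun p q hpq =>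
    amalgam_isPartite hπ l _ _ (hf p q hpq)
  obtain ⟨p, hpa, hpb⟩ : ∃ p, ρ (f p) ≠ a ∧ ρ (f p) ≠ b := by
    by_contra! h
    have h0 := h ⟨0, by omega⟩
    have h1 := h ⟨1, by omega⟩
    have h2 := h ⟨2, by omega⟩
    have h01 := hρ ⟨0, by omega⟩ ⟨1, by omega⟩ (by simp)
    have h02 := hρ ⟨0, by omega⟩ ⟨2, by omega⟩ (by simp)
    have h12 := hρ ⟨1, by omega⟩ ⟨2, by omega⟩ (by simp)
    rcases eq_or_ne (ρ (f ⟨0, by omega⟩)) a with e0 | e0 <;>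
    rcases eq_or_ne (ρ (f ⟨1, by omega⟩)) a with e1 | e1 <;>
    rcases eq_or_ne (ρ (f ⟨2, by omega⟩)) a with e2 | e2 <;>
    simp_all
  have : Nontrivial (Fin m) := Fin.nontrivial_iff_two_le.mpr (by omega)
  obtain ⟨q, hq⟩ := exists_ne p
  obtain ⟨L, x, -, hx, -, -⟩ := hf p q hq.symm
  have hxa : π x ≠ a := by rw [← amalgamProj_lineEmb X π a b i L x, hx]; exact hpa
  have hxb : π x ≠ b := by rw [← amalgamProj_lineEmb X π a b i L x, hx]; exact hpb
  have hrange : ∀ s, ∃ v, X.lineEmb π a b i L v = f s := by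
    intro s
    by_cases hs : s = p
    · exact ⟨x, by rw [hx, hs]⟩
    · obtain ⟨L', x', y, hx', hy, -⟩ := hf p s (Ne.symm hs)
      have := line_eq_of_lineEmb_eq hxa hxb (hx'.trans hx.symm)
      subst this
      exact ⟨y, hy⟩
  choose g hg using hrange
  refine hX l g fun s t hst => ?_
  obtain ⟨L', x', y', hx', hy', h⟩ := hf s t hst
  exact adj_of_lineEmb_eq hπ (hx'.trans (hg s).symm) (hy'.trans (hg t).symm) h

end Amalgam

theorem exists_constant_on_partEdges {m : ℕ} (hm : 3 ≤ m) [Finite V]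
    (X : ColoredGraph r V) {π : V → A} (hπ : X.IsPartite π) (hX : X.MonoCliqueFree m)
    (a b : A) (i : Fin r) :
    ∃ (W : Type) (_ : Finite W) (Y : ColoredGraph r W) (ρ : W → A),
      Y.IsPartite ρ ∧ Y.MonoCliqueFree m ∧ ∀ χ : Sym2 W → Fin r, ∃ φ : V → W,
        X.IsHom Y φ ∧ (∀ v, ρ (φ v) = π v) ∧
        ∃ d, ∀ x y, π x = a → π y = b → X.Adj i x y → χ s(φ x, φ y) = d := by
  obtain ⟨ι, _, hι⟩ := Combinatorics.Line.exists_mono_in_high_dimension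
    (X.PartEdge π a b i) (Fin r)
  have : Finite (Combinatorics.Line (X.PartEdge π a b i) ι) :=
    Finite.of_injective Combinatorics.Line.idxFun fun L L' h => by cases L; cases L'; congr
  refine ⟨_, inferInstance, X.amalgam π a b i ι hπ, X.amalgamProj π a b i,
    amalgam_isPartite hπ, amalgam_monoCliqueFree hπ hm hX, fun χ => ?_⟩
  obtain ⟨L, d, hd⟩ := hι fun e =>
    χ s(Sum.inl (false, fun t => (e t).1.1), Sum.inl (true, fun t => (e t).1.2))
  refine ⟨X.lineEmb π a b i L, fun l x y h => ⟨L, x, y, rfl, rfl, h⟩,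
    amalgamProj_lineEmb X π a b i L, d, fun x y hx hy h => ?_⟩
  have hab : b ≠ a := by rw [← hx, ← hy]; exact (hπ i x y h).symm
  rw [← hd ⟨(x, y), hx, hy, h⟩]
  simp only [lineEmb, hx, hy, hab, if_true, if_false, Combinatorics.Line.apply_def]
  congr 4
  · funext t
    cases L.idxFun t <;> rfl
  · funext t
    cases L.idxFun t <;> rfl

theorem exists_constant_on_all_partEdges {m : ℕ} (hm : 3 ≤ m) [Finite V]
    (X : ColoredGraph r V) {π : V → A} (hπ : X.IsPartite π) (hX : X.MonoCliqueFree m)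
    (S : Finset (A × A × Fin r)) :
    ∃ (W : Type) (_ : Finite W) (Y : ColoredGraph r W) (ρ : W → A),
      Y.IsPartite ρ ∧ Y.MonoCliqueFree m ∧ ∀ χ : Sym2 W → Fin r, ∃ φ : V → W,
        X.IsHom Y φ ∧ (∀ v, ρ (φ v) = π v) ∧
        ∀ a b i, (a, b, i) ∈ S →
          ∃ d, ∀ x y, π x = a → π y = b → X.Adj i x y → χ s(φ x, φ y) = d := by
  classical
  induction S using Finset.induction_on with
  | empty => exact ⟨V, inferInstance, X, π, hπ, hX, fun χ => ⟨id, fun _ _ _ h => h, by simp⟩⟩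
  | insert t S _ ih =>
    obtain ⟨a, b, i⟩ := t
    obtain ⟨W, _, Y, ρ, hρ, hY, h⟩ := ih
    obtain ⟨W', hW', Y', ρ', hρ', hY', h'⟩ := Y.exists_constant_on_partEdges hm hρ hY a b i
    refine ⟨W', hW', Y', ρ', hρ', hY', fun χ => ?_⟩
    obtain ⟨φ', hφ', hφ'π, d', hd'⟩ := h' χ
    obtain ⟨φ, hφ, hφπ, hd⟩ := h (χ ∘ Sym2.map φ')
    refine ⟨φ' ∘ φ, fun l x y h => hφ' _ _ _ (hφ _ _ _ h),
      fun v => (hφ'π _).trans (hφπ v), fun a₁ b₁ i₁ hmem => ?_⟩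
    rcases Finset.mem_insert.mp hmem with heq | hmem
    · simp only [Prod.mk.injEq] at heq
      obtain ⟨rfl, rfl, rfl⟩ := heq
      exact ⟨d', fun x y hx hy hxy =>
        hd' _ _ ((hφπ x).trans hx) ((hφπ y).trans hy) (hφ _ _ _ hxy)⟩
    · obtain ⟨d, hd⟩ := hd a₁ b₁ i₁ hmem
      exact ⟨d, fun x y hx hy hxy => hd x y hx hy hxy⟩

/-- The edge partition property of the class of coloured graphs without monochromatic complete
subgraphs on `m` vertices. -/
theorem exists_recoloring_factors {m : ℕ} (hm : 3 ≤ m) [Finite V]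
    (X : ColoredGraph r V) (hX : X.MonoCliqueFree m) :
    ∃ (W : Type) (_ : Finite W) (Y : ColoredGraph r W),
      Y.MonoCliqueFree m ∧ ∀ χ : Sym2 W → Fin r, ∃ φ : V → W, X.IsHom Y φ ∧
        ∃ g : Fin r → Fin r, ∀ i x y, X.Adj i x y → χ s(φ x, φ y) = g i := by
  classical
  have := Fintype.ofFinite V
  obtain ⟨R, hR⟩ := exists_monochromatic_subset (Fin r → Fin r) (Fintype.card V)
  let e := Fintype.equivFin V
  let X₀ : ColoredGraph r ((V ↪ Fin R) × V) :=
    { Adj := fun l x y => x.1 = y.1 ∧ X.Adj l x.2 y.2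
      symm := fun h => ⟨h.1.symm, X.symm h.2⟩
      irrefl := fun h => X.irrefl h.2
      eq_of_adj := fun h h' => X.eq_of_adj h.2 h'.2 }
  have hπ : X₀.IsPartite fun x => x.1 x.2 := by
    rintro i ⟨h, x⟩ ⟨_, y⟩ ⟨rfl, hxy⟩ heq
    rw [h.injective heq] at hxy
    exact X.irrefl hxy
  have hX₀ : X₀.MonoCliqueFree m := fun i f hf =>
    hX i (fun p => (f p).2) fun p q hpq => (hf p q hpq).2
  obtain ⟨W, hW, Y, _, -, hY, h⟩ := X₀.exists_constant_on_all_partEdges hm hπ hX₀ Finset.univ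
  refine ⟨W, hW, Y, hY, fun χ => ?_⟩
  obtain ⟨φ, hφ, -, hd⟩ := h χ
  choose d hd using fun a b i => hd a b i (Finset.mem_univ _)
  obtain ⟨h, hmono, g, hg⟩ := hR fun a b i => d a b i
  let h' : V ↪ Fin R := ⟨fun v => h (e v), hmono.injective.comp e.injective⟩
  refine ⟨fun v => φ (h', v), fun l x y hxy => hφ _ _ _ ⟨rfl, hxy⟩, g, ?_⟩
  have key : ∀ i x y, e x < e y → X.Adj i x y → χ s(φ (h', x), φ (h', y)) = g i := by
    intro i x y hlt hxy
    rw [hd (h' x) (h' y) i (h', x) (h', y) rfl rfl ⟨rfl, hxy⟩]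
    exact congrFun (hg _ _ hlt) i
  intro i x y hxy
  rcases lt_trichotomy (e x) (e y) with hlt | heq | hlt
  · exact key i x y hlt hxy
  · rw [e.injective heq] at hxy
    exact absurd hxy X.irrefl
  · rw [Sym2.eq_swap]
    exact key i y x hlt (X.symm hxy)


open Classical in
/-- The disjoint union of `X` with, for all colours `i ≠ j`, a complete graph on `m` vertices in
which one edge has colour `j` and all other edges have colour `i`. -/
noncomputable def addSeparators (X : ColoredGraph r V) (m : ℕ) :
    ColoredGraph r (V ⊕ (Fin r × Fin r) × Fin m) where
  Adj l
    | Sum.inl x, Sum.inl y => X.Adj l x y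
    | Sum.inr (c, p), Sum.inr (c', q) =>
      c = c' ∧ c.1 ≠ c.2 ∧ p ≠ q ∧ l = if p.val ≤ 1 ∧ q.val ≤ 1 then c.2 else c.1
    | _, _ => False
  symm := by
    rintro l (x | ⟨c, p⟩) (y | ⟨c', q⟩) h
    · exact X.symm h
    · exact h
    · exact h
    · obtain ⟨rfl, h1, h2, h3⟩ := h
      exact ⟨rfl, h1, h2.symm, by rw [h3]; simp only [and_comm]⟩
  irrefl := by
    rintro l (x | ⟨c, p⟩) h
    · exact X.irrefl h
    · exact h.2.2.1 rfl
  eq_of_adj := by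
    rintro l l' (x | ⟨c, p⟩) (y | ⟨c', q⟩) h h'
    · exact X.eq_of_adj h h'
    · exact h.elim
    · exact h.elim
    · exact h.2.2.2.trans h'.2.2.2.symm

theorem addSeparators_monoCliqueFree {X : ColoredGraph r V} {m : ℕ} (hm : 3 ≤ m)
    (hX : X.MonoCliqueFree m) : (X.addSeparators m).MonoCliqueFree m := by
  intro l f hf
  rcases h0 : f ⟨0, by omega⟩ with x₀ | ⟨c, p₀⟩
  · have h : ∀ p, ∃ x, f p = Sum.inl x := by
      intro p
      by_cases hp : p = ⟨0, by omega⟩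
      · exact ⟨x₀, by rw [hp, h0]⟩
      · have := hf _ _ hp
        rw [h0] at this
        rcases hfp : f p with x | ⟨c, q⟩
        · exact ⟨x, rfl⟩
        · rw [hfp] at this
          exact this.elim
    choose g hg using h
    refine hX l g fun p q hpq => ?_
    have := hf p q hpq
    rwa [hg, hg] at this
  · have h : ∀ p, ∃ q, f p = Sum.inr (c, q) := by
      intro p
      by_cases hp : p = ⟨0, by omega⟩
      · exact ⟨p₀, by rw [hp, h0]⟩
      · have := hf _ _ hp
        rw [h0] at this
        rcases hfp : f p with x | ⟨c', q⟩
        · rw [hfp] at this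
          exact this.elim
        · rw [hfp] at this
          exact ⟨q, by rw [this.1]⟩
    choose g hg using h
    have hadj : ∀ p q, p ≠ q → c = c ∧ c.1 ≠ c.2 ∧ g p ≠ g q ∧
        l = if (g p).val ≤ 1 ∧ (g q).val ≤ 1 then c.2 else c.1 := by
      intro p q hpq
      have := hf p q hpq
      rwa [hg, hg] at this
    have hinj : Function.Injective g := fun p q hpq => by
      by_contra hne
      exact (hadj p q hne).2.2.1 hpq
    have hsurj := Finite.surjective_of_injective hinj
    obtain ⟨p, hp⟩ := hsurj ⟨0, by omega⟩
    obtain ⟨q, hq⟩ := hsurj ⟨1, by omega⟩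
    obtain ⟨s, hs⟩ := hsurj ⟨2, by omega⟩
    have hpq := hadj p q (by rintro rfl; simp [hp] at hq)
    have hps := hadj p s (by rintro rfl; simp [hp] at hs)
    simp only [hp, hq, hs] at hpq hps
    norm_num at hpq hps
    exact hpq.1 (hps.2.symm.trans hpq.2)

/-- For every coloured graph `X` without monochromatic complete subgraphs on `m` vertices there is
another such graph in which every recolouring contains a monochromatic complete subgraph on `m`
vertices or a copy of `X`, up to a permutation of the colours. -/
theorem exists_recoloring_contains_permuted {m : ℕ} (hm : 3 ≤ m) [Finite V]
    (X : ColoredGraph r V) (hX : X.MonoCliqueFree m) :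
    ∃ (W : Type) (_ : Finite W) (Y : ColoredGraph r W),
      Y.MonoCliqueFree m ∧ ∀ χ : Sym2 W → Fin r,
        (∃ i, ∃ f : Fin m → W, ∀ p q, p ≠ q →
          (∃ l, Y.Adj l (f p) (f q)) ∧ χ s(f p, f q) = i) ∨
        ∃ φ : V → W, X.IsHom Y φ ∧
          ∃ σ : Equiv.Perm (Fin r), ∀ i x y, X.Adj i x y → χ s(φ x, φ y) = σ i := by
  classical
  obtain ⟨W, hW, Y, hY, h⟩ := (X.addSeparators m).exists_recoloring_factors hm
    (addSeparators_monoCliqueFree hm hX)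
  refine ⟨W, hW, Y, hY, fun χ => ?_⟩
  obtain ⟨φ, hφ, g, hg⟩ := h χ
  by_cases hinj : Function.Injective g
  · exact Or.inr ⟨fun x => φ (Sum.inl x), fun l x y hxy => hφ l _ _ hxy,
      Equiv.ofBijective g (Finite.injective_iff_bijective.mp hinj),
      fun i x y hxy => hg i _ _ hxy⟩
  · obtain ⟨i, j, hij, hne⟩ := Function.not_injective_iff.mp hinj
    refine Or.inl ⟨g i, fun p => φ (Sum.inr ((i, j), p)), fun p q hpq => ?_⟩
    have hadj : (X.addSeparators m).Adj (if p.val ≤ 1 ∧ q.val ≤ 1 then j else i)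
        (Sum.inr ((i, j), p)) (Sum.inr ((i, j), q)) := ⟨rfl, hne, hpq, rfl⟩
    refine ⟨⟨_, hφ _ _ _ hadj⟩, ?_⟩
    rw [hg _ _ _ hadj]
    split_ifs
    · exact hij.symm
    · rfl

end ColoredGraph

theorem isRamsey_iff {V : Type*} {G : SimpleGraph V} {r n : ℕ} :
    IsRamsey G r n ↔ ∀ c : Sym2 V → Fin r, ∃ i, ∃ f : Fin n → V,
      ∀ p q, p ≠ q → G.Adj (f p) (f q) ∧ c s(f p, f q) = i := by
  classical
  refine forall_congr' fun c => exists_congr fun i => ⟨?_, ?_⟩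
  · rintro ⟨S, hS, h⟩
    let e := S.equivFinOfCardEq hS
    exact ⟨fun p => e.symm p, fun p q hpq => h _ (e.symm p).2 _ (e.symm q).2
      fun h => hpq (e.symm.injective (Subtype.ext h))⟩
  · rintro ⟨f, hf⟩
    have hinj : Function.Injective f := fun p q hpq => by
      by_contra hne
      exact (hf p q hne).1.ne hpq
    refine ⟨Finset.univ.map ⟨f, hinj⟩, by simp, ?_⟩
    simp only [Finset.mem_map, Finset.mem_univ, true_and, Function.Embedding.coeFn_mk]
    rintro _ ⟨p, rfl⟩ _ ⟨q, rfl⟩ hpq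
    exact hf p q fun h => hpq (congrArg f h)

theorem IsRamsey.of_hom {V V' : Type*} {G : SimpleGraph V} {G' : SimpleGraph V'} {r n : ℕ}
    (h : IsRamsey G r n) (φ : G →g G') : IsRamsey G' r n := by
  rw [isRamsey_iff] at h ⊢
  intro c
  obtain ⟨i, f, hf⟩ := h (c ∘ Sym2.map φ)
  exact ⟨i, φ ∘ f, fun p q hpq => ⟨φ.map_adj (hf p q hpq).1, (hf p q hpq).2⟩⟩

theorem exists_isRamseyMinimal_of_mem_verts {V : Type} [Finite V] {G : SimpleGraph V} {r n N : ℕ}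
    (hG : IsRamsey G r n) (v : V) (hdeg : (G.neighborSet v).ncard ≤ N)
    (hv : ∀ H : G.Subgraph, IsRamsey H.coe r n → v ∈ H.verts) :
    ∃ (t : ℕ) (G' : SimpleGraph (Fin t)), IsRamseyMinimal G' r n ∧ minDeg G' ≤ N := by
  classical
  have := Fintype.ofFinite V
  obtain ⟨H, hH⟩ := (Set.toFinite {H : G.Subgraph | IsRamsey H.coe r n}).exists_minimal
    ⟨⊤, hG.of_hom SimpleGraph.Subgraph.topIso.symm.toHom⟩
  have hvH := hv H hH.prop
  let e : H.verts ≃ Fin (Fintype.card H.verts) := Fintype.equivFin _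
  let G' : SimpleGraph (Fin (Fintype.card H.verts)) := H.coe.map e.toEmbedding
  let ψ : H.coe ≃g G' := SimpleGraph.Iso.map e H.coe
  refine ⟨_, G', ⟨hH.prop.of_hom ψ.toHom, fun K hK hKR => hK ?_⟩, ?_⟩
  · let θ : G' →g G := H.hom.comp ψ.symm.toHom
    have hθ : ∀ x, θ x = (e.symm x : V) := fun x => rfl
    have hθinj : Function.Injective θ := fun x y h => e.symm.injective (Subtype.ext h)
    have hle : K.map θ ≤ H := by
      constructor
      · rintro _ ⟨x, -, rfl⟩
        exact (e.symm x).2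
      · rintro _ _ ⟨x, y, hxy, rfl, rfl⟩
        exact ψ.symm.toHom.map_adj (K.adj_sub hxy)
    have hKH : IsRamsey (K.map θ).coe r n := by
      refine hKR.of_hom ⟨fun x => ⟨θ x, ⟨x, x.2, rfl⟩⟩, fun {x y} hxy => ?_⟩
      exact ⟨x, y, hxy, rfl, rfl⟩
    have heq : K.map θ = H := le_antisymm hle (hH.le_of_le hKH hle)
    ext x y
    · simp only [SimpleGraph.Subgraph.verts_top, Set.mem_univ, iff_true]
      have : θ x ∈ (K.map θ).verts := by rw [heq]; exact (e.symm x).2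
      obtain ⟨x', hx', h⟩ := this
      rwa [← hθinj h]
    · simp only [SimpleGraph.Subgraph.top_adj]
      refine ⟨fun h => K.adj_sub h, fun h => ?_⟩
      have : (K.map θ).Adj (θ x) (θ y) := by
        rw [heq]; exact ψ.symm.toHom.map_adj h
      obtain ⟨x', y', hx', h1, h2⟩ := this
      rwa [← hθinj h1, ← hθinj h2]
  · let w := e ⟨v, hvH⟩
    have h1 : minDeg G' ≤ (G'.neighborSet w).ncard := by
      unfold minDeg
      let := Classical.decRel G'.Adj
      refine (G'.minDegree_le_degree w).trans_eq ?_
      rw [← SimpleGraph.card_neighborSet_eq_degree, Set.ncard_eq_toFinset_card',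
        Set.toFinset_card]
    refine h1.trans (le_trans ?_ hdeg)
    refine Set.ncard_le_ncard_of_injOn (fun x => (e.symm x : V)) ?_ ?_ (Set.toFinite _)
    · intro x hx
      have := H.coe_adj_sub _ _ (ψ.symm.toHom.map_adj hx)
      have hw : ψ.symm.toHom w = ⟨v, hvH⟩ := e.symm_apply_apply _
      rw [hw] at this
      exact this
    · intro x _ y _ h
      exact e.symm.injective (Subtype.ext h)

/-- The graph `F` together with, for every `φ ∈ T`, a new vertex joined to the range of `φ`. -/
def attachVertices {V W : Type} (F : SimpleGraph W) (T : Finset (V → W)) :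
    SimpleGraph (W ⊕ (V → W)) where
  Adj
    | Sum.inl x, Sum.inl y => F.Adj x y
    | Sum.inl x, Sum.inr φ => φ ∈ T ∧ x ∈ Set.range φ
    | Sum.inr φ, Sum.inl x => φ ∈ T ∧ x ∈ Set.range φ
    | Sum.inr _, Sum.inr _ => False
  symm := ⟨by
    rintro (x | φ) (y | ψ) h
    · exact F.adj_symm h
    · exact h
    · exact h
    · exact h⟩
  loopless := ⟨by
    rintro (x | φ) h
    · exact F.irrefl h
    · exact h⟩

theorem exists_isRamseyMinimal_of_pattern {V : Type} [Fintype V] {r m : ℕ} (hr : 0 < r)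
    (hm : 2 ≤ m) (X : ColoredGraph r V) (hX : X.MonoCliqueFree (m + 1))
    (hpat : ∀ c : V → Fin r, ∃ i, ∃ f : Fin m → V,
      (∀ p, c (f p) = i) ∧ ∀ p q, p ≠ q → X.Adj i (f p) (f q)) :
    ∃ (t : ℕ) (G : SimpleGraph (Fin t)),
      IsRamseyMinimal G r (m + 1) ∧ minDeg G ≤ Fintype.card V := by
  classical
  obtain ⟨W, _, Y, hY, hχ⟩ := X.exists_recoloring_contains_permuted (m := m + 1) (by omega) hX
  have := Fintype.ofFinite W
  let F : SimpleGraph W :=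
    { Adj := fun x y => ∃ l, Y.Adj l x y
      symm := ⟨fun x y ⟨l, h⟩ => ⟨l, Y.symm h⟩⟩
      loopless := ⟨fun x ⟨l, h⟩ => Y.irrefl h⟩ }
  have hempty : ¬ IsRamsey (attachVertices F (∅ : Finset (V → W))) r (m + 1) := by
    rw [isRamsey_iff]
    intro h
    let c : Sym2 (W ⊕ (V → W)) → Fin r := fun e =>
      if h : ∃ l x y, Y.Adj l x y ∧ e = s(Sum.inl x, Sum.inl y) then h.choose else ⟨0, hr⟩
    have hc : ∀ l x y, Y.Adj l x y → c s(Sum.inl x, Sum.inl y) = l := by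
      intro l x y hxy
      have hex : ∃ l' x' y', Y.Adj l' x' y' ∧
          (s(Sum.inl x, Sum.inl y) : Sym2 (W ⊕ (V → W))) = s(Sum.inl x', Sum.inl y') :=
        ⟨l, x, y, hxy, rfl⟩
      have hdef : c s(Sum.inl x, Sum.inl y) = hex.choose := dif_pos hex
      rw [hdef]
      obtain ⟨x', y', h1, h2⟩ := hex.choose_spec
      simp only [Sym2.eq_iff, Sum.inl.injEq] at h2
      rcases h2 with ⟨rfl, rfl⟩ | ⟨rfl, rfl⟩
      · exact Y.eq_of_adj h1 hxy
      · exact Y.eq_of_adj h1 (Y.symm hxy)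
    obtain ⟨i, f, hf⟩ := h c
    have hleft : ∀ p, ∃ x, f p = Sum.inl x := by
      intro p
      have : Nontrivial (Fin (m + 1)) := Fin.nontrivial_iff_two_le.mpr (by omega)
      obtain ⟨q, hq⟩ := exists_ne p
      have h := (hf p q hq.symm).1
      rcases hp : f p with x | φ
      · exact ⟨x, rfl⟩
      · rcases hq : f q with y | ψ
        · rw [hp, hq] at h
          exact absurd h.1 (Finset.notMem_empty _)
        · rw [hp, hq] at h
          exact h.elim
    choose g hg using hleft
    refine hY i g fun p q hpq => ?_
    obtain ⟨h1, h2⟩ := hf p q hpq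
    rw [hg, hg] at h1 h2
    obtain ⟨l, hl⟩ := h1
    rwa [← h2, hc l _ _ hl]
  have huniv : IsRamsey (attachVertices F (Finset.univ : Finset (V → W))) r (m + 1) := by
    rw [isRamsey_iff]
    intro c
    rcases hχ (c ∘ Sym2.map Sum.inl) with ⟨i, f, hf⟩ | ⟨φ, hφ, σ, hσ⟩
    · exact ⟨i, fun p => Sum.inl (f p), hf⟩
    · obtain ⟨i, f, hfc, hf⟩ := hpat fun x => σ.symm (c s(Sum.inl (φ x), Sum.inr φ))
      have hfc' : ∀ p, c s(Sum.inl (φ (f p)), Sum.inr φ) = σ i := fun p => by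
        rw [← hfc p, Equiv.apply_symm_apply]
      refine ⟨σ i, Fin.cons (Sum.inr φ) fun p => Sum.inl (φ (f p)), fun p q hpq => ?_⟩
      induction p using Fin.cases with
      | zero =>
        induction q using Fin.cases with
        | zero => exact absurd rfl hpq
        | succ q =>
          refine ⟨⟨Finset.mem_univ _, ⟨f q, rfl⟩⟩, ?_⟩
          rw [Sym2.eq_swap]
          exact hfc' q
      | succ p =>
        induction q using Fin.cases with
        | zero => exact ⟨⟨Finset.mem_univ _, ⟨f p, rfl⟩⟩, hfc' p⟩
        | succ q =>
          have hadj := hf p q fun h => hpq (congrArg Fin.succ h)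
          exact ⟨⟨i, hφ _ _ _ hadj⟩, hσ _ _ _ hadj⟩
  obtain ⟨T, φ, hT, hφT⟩ : ∃ (T : Finset (V → W)) (φ : V → W),
      ¬ IsRamsey (attachVertices F T) r (m + 1) ∧
      IsRamsey (attachVertices F (insert φ T)) r (m + 1) := by
    by_contra! h
    have hall : ∀ T : Finset (V → W), ¬ IsRamsey (attachVertices F T) r (m + 1) := by
      intro T
      induction T using Finset.induction_on with
      | empty => exact hempty
      | insert φ T _ ih => exact h T φ ih
    exact hall _ huniv
  refine exists_isRamseyMinimal_of_mem_verts hφT (Sum.inr φ) ?_ fun H hH => ?_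
  · have hsub : (attachVertices F (insert φ T)).neighborSet (Sum.inr φ) ⊆
        Set.range fun x => (Sum.inl (φ x) : W ⊕ (V → W)) := by
      rintro (x | ψ) h
      · obtain ⟨-, y, rfl⟩ := h
        exact ⟨y, rfl⟩
      · exact h.elim
    refine (Set.ncard_le_ncard hsub (Set.toFinite _)).trans ?_
    rw [← Set.image_univ]
    refine (Set.ncard_image_le Set.finite_univ).trans_eq ?_
    rw [Set.ncard_univ, Nat.card_eq_fintype_card]
  · by_contra hmem
    refine hT (hH.of_hom ⟨fun x => x.1, ?_⟩)
    have hne : ∀ {ψ : V → W}, Sum.inr ψ ∈ H.verts → ψ ∈ insert φ T → ψ ∈ T := by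
      intro ψ hψ hψT
      rcases Finset.mem_insert.mp hψT with rfl | h
      · exact absurd hψ hmem
      · exact h
    rintro ⟨x | ψ, hx⟩ ⟨y | ψ', hy⟩ hxy
    · exact H.adj_sub hxy
    · have h := H.adj_sub hxy
      exact ⟨hne hy h.1, h.2⟩
    · have h := H.adj_sub hxy
      exact ⟨hne hx h.1, h.2⟩
    · exact (H.adj_sub hxy).elim

theorem card_functions_missing_value_le {F : Type} [Fintype F] [DecidableEq F] (k : ℕ)
    (U : Finset F) :
    (Finset.univ.filter fun g : F → Fin k => ∃ j, ∀ t ∈ U, g t ≠ j).card ≤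
      k * ((k - 1) ^ U.card * k ^ (Fintype.card F - U.card)) := by
  classical
  have hsub : (Finset.univ.filter fun g : F → Fin k => ∃ j, ∀ t ∈ U, g t ≠ j) ⊆
      Finset.univ.biUnion fun j : Fin k =>
        Fintype.piFinset fun t => if t ∈ U then Finset.univ.erase j else Finset.univ := by
    intro g hg
    obtain ⟨j, hj⟩ := (Finset.mem_filter.mp hg).2
    refine Finset.mem_biUnion.mpr ⟨j, Finset.mem_univ _, Fintype.mem_piFinset.mpr fun t => ?_⟩
    split_ifs with ht
    · exact Finset.mem_erase.mpr ⟨hj t ht, Finset.mem_univ _⟩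
    · exact Finset.mem_univ _
  refine (Finset.card_le_card hsub).trans ((Finset.card_biUnion_le_card_mul _ _
    ((k - 1) ^ U.card * k ^ (Fintype.card F - U.card)) ?_).trans_eq ?_)
  · intro j _
    rw [Fintype.card_piFinset]
    have : ∀ t, (if t ∈ U then Finset.univ.erase j else Finset.univ : Finset (Fin k)).card =
        if t ∈ U then k - 1 else k := by
      intro t
      split_ifs <;> simp
    simp only [this]
    rw [Finset.prod_ite, Finset.prod_const, Finset.prod_const]
    have h1 : (Finset.univ.filter fun t => t ∈ U) = U := by ext; simp
    have h2 : (Finset.univ.filter fun t => t ∉ U) = Uᶜ := by ext; simp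
    rw [h1, h2, Finset.card_compl]
  · simp

theorem card_assignments_missing_value_le {Λ F : Type} [Fintype Λ] [DecidableEq Λ] [Fintype F]
    [DecidableEq F] {k : ℕ} (hk : 2 ≤ k) (U : Λ → Finset F) :
    ((Finset.univ.filter fun f : Λ → F → Fin k => ∀ ℓ, ∃ j, ∀ t ∈ U ℓ, f ℓ t ≠ j).card : ℝ) ≤
      (k : ℝ) ^ (Fintype.card F * Fintype.card Λ) * (k : ℝ) ^ Fintype.card Λ *
        Real.exp (-((∑ ℓ, (U ℓ).card : ℕ) : ℝ) / k) := by
  classical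
  have hk0 : (0 : ℝ) < k := by positivity
  have heq : (Finset.univ.filter fun f : Λ → F → Fin k => ∀ ℓ, ∃ j, ∀ t ∈ U ℓ, f ℓ t ≠ j) =
      Fintype.piFinset fun ℓ =>
        Finset.univ.filter fun g : F → Fin k => ∃ j, ∀ t ∈ U ℓ, g t ≠ j := by
    ext f
    simp [Fintype.mem_piFinset]
  rw [heq, Fintype.card_piFinset, Nat.cast_prod]
  have hfac : ∀ ℓ ∈ (Finset.univ : Finset Λ),
      ((Finset.univ.filter fun g : F → Fin k => ∃ j, ∀ t ∈ U ℓ, g t ≠ j).card : ℝ) ≤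
        (k : ℝ) ^ Fintype.card F * k * Real.exp (-((U ℓ).card : ℝ) / k) := by
    intro ℓ _
    have hU : (U ℓ).card ≤ Fintype.card F := Finset.card_le_univ _
    have h1 : ((k - 1 : ℕ) : ℝ) ≤ k * Real.exp (-1 / k) := by
      rw [Nat.cast_sub (by omega), Nat.cast_one]
      have h2 := Real.add_one_le_exp (-1 / k : ℝ)
      have h3 : (k : ℝ) * (-1 / k + 1) = k - 1 := by field_simp; ring
      rw [← h3]
      gcongr
    have h4 : Real.exp (-((U ℓ).card : ℝ) / k) = Real.exp (-1 / k) ^ (U ℓ).card := by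
      rw [← Real.exp_nat_mul]
      congr 1
      ring
    calc ((Finset.univ.filter fun g : F → Fin k => ∃ j, ∀ t ∈ U ℓ, g t ≠ j).card : ℝ)
        ≤ k * (((k - 1 : ℕ) : ℝ) ^ (U ℓ).card * k ^ (Fintype.card F - (U ℓ).card)) := by
          exact_mod_cast card_functions_missing_value_le k (U ℓ)
      _ ≤ k * ((k * Real.exp (-1 / k)) ^ (U ℓ).card * k ^ (Fintype.card F - (U ℓ).card)) := by
          gcongr
      _ = (k : ℝ) ^ Fintype.card F * k * Real.exp (-((U ℓ).card : ℝ) / k) := by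
          rw [h4, mul_pow, ← pow_mul_pow_sub (k : ℝ) hU]
          ring
  refine (Finset.prod_le_prod (fun _ _ => Nat.cast_nonneg _) hfac).trans_eq ?_
  rw [Finset.prod_mul_distrib, Finset.prod_const, mul_pow, ← pow_mul, Finset.card_univ,
    ← Real.exp_sum]
  congr 2
  rw [← Finset.sum_div, Finset.sum_neg_distrib, Nat.cast_sum]

/-- A random partition of every line into `k` parts has, with positive probability, a line all of
whose parts meet `S`, for every set `S` of at least a `1 / r` fraction of the points. -/
theorem exists_line_partition {Λ V F : Type} [Fintype Λ] [Fintype V] [Nonempty V] [Fintype F]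
    [DecidableEq V] {k r q : ℕ} (hk : 2 ≤ k) (hr : 0 < r) (pt : Λ → F → V)
    (hcard : Fintype.card Λ = Fintype.card V)
    (hinc : ∀ v, q ≤ (Finset.univ.filter fun x : Λ × F => pt x.1 x.2 = v).card)
    (hq : 4 * k * r * Real.log k ≤ q) :
    ∃ f : Λ → F → Fin k, ∀ S : Finset V, Fintype.card V ≤ r * S.card →
      ∃ ℓ, ∀ j, ∃ t, pt ℓ t ∈ S ∧ f ℓ t = j := by
  classical
  set n := Fintype.card V with hn
  have hn0 : 0 < n := Fintype.card_pos
  have hk0 : (0 : ℝ) < k := by positivity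
  have hr0 : (0 : ℝ) < r := by positivity
  let U : Finset V → Λ → Finset F := fun S ℓ => Finset.univ.filter fun t => pt ℓ t ∈ S
  let B : Finset V → Finset (Λ → F → Fin k) := fun S =>
    Finset.univ.filter fun f => ∀ ℓ, ∃ j, ∀ t ∈ U S ℓ, f ℓ t ≠ j
  have hsum : ∀ S, S.card * q ≤ ∑ ℓ, (U S ℓ).card := by
    intro S
    have h1 : ∑ ℓ, (U S ℓ).card = (Finset.univ.filter fun x : Λ × F => pt x.1 x.2 ∈ S).card := by
      simp only [U, Finset.card_filter]
      rw [Fintype.sum_prod_type]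
    rw [h1, Finset.card_eq_sum_card_fiberwise
      (s := Finset.univ.filter fun x : Λ × F => pt x.1 x.2 ∈ S)
      (f := fun x : Λ × F => pt x.1 x.2) (t := S) (fun x hx => (Finset.mem_filter.mp hx).2), ← smul_eq_mul]
    refine Finset.card_nsmul_le_sum _ _ _ fun v hv => (hinc v).trans (Finset.card_le_card ?_)
    intro x hx
    have hx := (Finset.mem_filter.mp hx).2
    simp only [Finset.mem_filter, Finset.mem_univ, true_and]
    exact ⟨by rw [hx]; exact hv, hx⟩
  have hB : ∀ S, n ≤ r * S.card →
      ((B S).card : ℝ) * (k : ℝ) ^ (3 * n) ≤ (k : ℝ) ^ (Fintype.card F * n) := by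
    intro S hS
    have h1 := card_assignments_missing_value_le hk (U S)
    rw [hcard] at h1
    have h2 : Real.exp (-((∑ ℓ, (U S ℓ).card : ℕ) : ℝ) / k) ≤ ((k : ℝ) ^ (4 * n))⁻¹ := by
      have h3 : ((k : ℝ) ^ (4 * n))⁻¹ = Real.exp (-((4 * n : ℕ) * Real.log k)) := by
        rw [Real.exp_neg, Real.exp_nat_mul, Real.exp_log hk0]
      rw [h3]
      refine Real.exp_le_exp.mpr ?_
      rw [neg_div, neg_le_neg_iff, le_div_iff₀ hk0]
      have h4 : ((S.card * q : ℕ) : ℝ) ≤ ((∑ ℓ, (U S ℓ).card : ℕ) : ℝ) := by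
        exact_mod_cast hsum S
      refine le_trans ?_ h4
      have h5 : (n : ℝ) ≤ r * S.card := by exact_mod_cast hS
      have hlog : 0 ≤ Real.log k := Real.log_natCast_nonneg k
      push_cast
      calc 4 * (n : ℝ) * Real.log k * k ≤ 4 * (r * S.card) * Real.log k * k := by gcongr
        _ = S.card * (4 * k * r * Real.log k) := by ring
        _ ≤ S.card * q := by gcongr
    have hpow : (0 : ℝ) < (k : ℝ) ^ (4 * n) := by positivity
    calc ((B S).card : ℝ) * (k : ℝ) ^ (3 * n)
        ≤ ((k : ℝ) ^ (Fintype.card F * n) * (k : ℝ) ^ n * ((k : ℝ) ^ (4 * n))⁻¹) *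
            (k : ℝ) ^ (3 * n) := by
          gcongr
          exact h1.trans (by gcongr)
      _ = (k : ℝ) ^ (Fintype.card F * n) * ((k : ℝ) ^ (4 * n))⁻¹ * (k : ℝ) ^ (4 * n) := by ring
      _ = (k : ℝ) ^ (Fintype.card F * n) := inv_mul_cancel_right₀ hpow.ne' _
  by_contra! hcon
  have hcover : (Finset.univ : Finset (Λ → F → Fin k)) ⊆
      (Finset.univ.filter fun S : Finset V => n ≤ r * S.card).biUnion B := by
    intro f _
    obtain ⟨S, hS, hf⟩ := hcon f
    refine Finset.mem_biUnion.mpr ⟨S, by simpa using hS, ?_⟩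
    simp only [B, U, Finset.mem_filter, Finset.mem_univ, true_and]
    intro ℓ
    obtain ⟨j, hj⟩ := hf ℓ
    exact ⟨j, fun t ht => hj t ht⟩
  have htotal : (Fintype.card (Λ → F → Fin k) : ℝ) = (k : ℝ) ^ (Fintype.card F * n) := by
    simp [hcard, pow_mul]
  have hle : (k : ℝ) ^ (Fintype.card F * n) ≤
      ∑ S ∈ Finset.univ.filter (fun S : Finset V => n ≤ r * S.card), ((B S).card : ℝ) := by
    rw [← htotal, ← Finset.card_univ]
    exact_mod_cast (Finset.card_le_card hcover).trans Finset.card_biUnion_le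
  have hM : (0 : ℝ) < (k : ℝ) ^ (Fintype.card F * n) := by positivity
  have hle2 : (k : ℝ) ^ (Fintype.card F * n) * (k : ℝ) ^ (3 * n) ≤
      2 ^ n * (k : ℝ) ^ (Fintype.card F * n) := by
    calc (k : ℝ) ^ (Fintype.card F * n) * (k : ℝ) ^ (3 * n)
        ≤ (∑ S ∈ Finset.univ.filter (fun S : Finset V => n ≤ r * S.card), ((B S).card : ℝ)) *
            (k : ℝ) ^ (3 * n) := by gcongr
      _ = ∑ S ∈ Finset.univ.filter (fun S : Finset V => n ≤ r * S.card),
            ((B S).card : ℝ) * (k : ℝ) ^ (3 * n) := Finset.sum_mul _ _ _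
      _ ≤ ∑ S ∈ Finset.univ.filter (fun S : Finset V => n ≤ r * S.card),
            (k : ℝ) ^ (Fintype.card F * n) :=
          Finset.sum_le_sum fun S hS => hB S (Finset.mem_filter.mp hS).2
      _ = ((Finset.univ.filter fun S : Finset V => n ≤ r * S.card).card : ℝ) *
            (k : ℝ) ^ (Fintype.card F * n) := by rw [Finset.sum_const, nsmul_eq_mul]
      _ ≤ 2 ^ n * (k : ℝ) ^ (Fintype.card F * n) := by
          gcongr
          have := Finset.card_le_univ (Finset.univ.filter fun S : Finset V => n ≤ r * S.card)
          rw [Fintype.card_finset] at this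
          exact_mod_cast this
  have h2k : (2 : ℝ) ^ n < (k : ℝ) ^ (3 * n) := by
    calc (2 : ℝ) ^ n < 2 ^ (3 * n) := pow_lt_pow_right₀ (by norm_num) (by omega)
      _ ≤ (k : ℝ) ^ (3 * n) := by
        gcongr
        exact_mod_cast hk
  nlinarith

section Geometry

variable {F : Type} [Field F]

/-- The point with first coordinate `t` on the line through `(0, b, c)` in the direction
`(1, a, a ^ 2 + μ)`, where `ℓ = (a, b, c)`. -/
def linePoint (μ : F) (ℓ : F × F × F) (t : F) : F × F × F :=
  (t, ℓ.2.1 + t * ℓ.1, ℓ.2.2 + t * (ℓ.1 ^ 2 + μ))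

theorem linePoint_eq_of_slope_eq {μ s : F} {ℓ ℓ' : F × F × F} (h : ℓ.1 = ℓ'.1)
    (hs : linePoint μ ℓ s = linePoint μ ℓ' s) : ℓ = ℓ' := by
  obtain ⟨a, b, c⟩ := ℓ
  obtain ⟨a', b', c'⟩ := ℓ'
  simp only [linePoint, Prod.mk.injEq] at *
  obtain ⟨-, h1, h2⟩ := hs
  subst h
  exact ⟨rfl, add_right_cancel h1, add_right_cancel h2⟩

theorem slope_eq_of_linePoint_eq {μ μ' s t : F} {ℓ ℓ' : F × F × F} (hst : s ≠ t)
    (hs : linePoint μ ℓ s = linePoint μ' ℓ' s) (ht : linePoint μ ℓ t = linePoint μ' ℓ' t) :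
    ℓ.1 = ℓ'.1 ∧ μ = μ' := by
  simp only [linePoint, Prod.mk.injEq, true_and] at hs ht
  have hst' : s - t ≠ 0 := sub_ne_zero.mpr hst
  have h1 : ℓ.1 = ℓ'.1 := mul_left_cancel₀ hst' (by linear_combination hs.1 - ht.1)
  refine ⟨h1, mul_left_cancel₀ hst' ?_⟩
  have h2 := hs.2
  have h3 := ht.2
  rw [h1] at h2 h3
  linear_combination h2 - h3

theorem line_eq_of_two_points {μ s t : F} {ℓ ℓ' : F × F × F} (hst : s ≠ t)
    (hs : linePoint μ ℓ s = linePoint μ ℓ' s) (ht : linePoint μ ℓ t = linePoint μ ℓ' t) :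
    ℓ = ℓ' :=
  linePoint_eq_of_slope_eq (slope_eq_of_linePoint_eq hst hs ht).1 hs

/-- Lines whose directions lie on a common parabola contain no triangle. -/
theorem line_eq_of_triangle {μ s t u : F} {ℓ₁ ℓ₂ ℓ₃ : F × F × F} (hst : s ≠ t) (htu : t ≠ u)
    (hs : linePoint μ ℓ₁ s = linePoint μ ℓ₃ s) (ht : linePoint μ ℓ₁ t = linePoint μ ℓ₂ t)
    (hu : linePoint μ ℓ₂ u = linePoint μ ℓ₃ u) : ℓ₁ = ℓ₂ := by
  refine linePoint_eq_of_slope_eq ?_ ht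
  simp only [linePoint, Prod.mk.injEq, true_and] at hs ht hu
  have h1 : (t - s) * ℓ₁.1 + (u - t) * ℓ₂.1 = (u - s) * ℓ₃.1 := by
    linear_combination ht.1 - hs.1 + hu.1
  have h2 : (t - s) * ℓ₁.1 ^ 2 + (u - t) * ℓ₂.1 ^ 2 = (u - s) * ℓ₃.1 ^ 2 := by
    linear_combination ht.2 - hs.2 + hu.2
  have h3 : (t - s) * (u - t) * (ℓ₁.1 - ℓ₂.1) ^ 2 = 0 := by
    linear_combination (u - s) * h2 -
      ((t - s) * ℓ₁.1 + (u - t) * ℓ₂.1 + (u - s) * ℓ₃.1) * h1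
  have h4 : (t - s) * (u - t) ≠ 0 :=
    mul_ne_zero (sub_ne_zero.mpr hst.symm) (sub_ne_zero.mpr htu.symm)
  exact sub_eq_zero.mp (pow_eq_zero_iff (by norm_num)|>.mp ((mul_eq_zero.mp h3).resolve_left h4))

theorem card_le_card_incident [Fintype F] [DecidableEq F] (μ : F) (v : F × F × F) :
    Fintype.card F ≤
      (Finset.univ.filter fun x : (F × F × F) × F => linePoint μ x.1 x.2 = v).card := by
  rw [← Finset.card_univ]
  refine Finset.card_le_card_of_injOn
    (fun a => ((a, v.2.1 - v.1 * a, v.2.2 - v.1 * (a ^ 2 + μ)), v.1)) ?_ ?_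
  · intro a _
    refine Finset.mem_coe.mpr (Finset.mem_filter.mpr ⟨Finset.mem_univ _, ?_⟩)
    exact Prod.ext rfl (Prod.ext (by simp [linePoint]) (by simp [linePoint]))
  · intro a _ b _ h
    exact congrArg (fun x => x.1.1) h

/-- In colour `i`, the points of every line with direction in the `i`-th parabola form a complete
multipartite graph, whose parts are given by `f i`. -/
def lineGraph {r k : ℕ} {μ : Fin r → F} (hμ : Function.Injective μ)
    (f : Fin r → F × F × F → F → Fin k) : ColoredGraph r (F × F × F) where
  Adj i x y := ∃ ℓ s t, linePoint (μ i) ℓ s = x ∧ linePoint (μ i) ℓ t = y ∧ f i ℓ s ≠ f i ℓ t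
  symm := by
    rintro i x y ⟨ℓ, s, t, hs, ht, h⟩
    exact ⟨ℓ, t, s, ht, hs, h.symm⟩
  irrefl := by
    rintro i x ⟨ℓ, s, t, rfl, ht, h⟩
    have : t = s := congrArg Prod.fst ht
    exact h (by rw [this])
  eq_of_adj := by
    rintro i j _ _ ⟨ℓ, s, t, rfl, rfl, h⟩ ⟨ℓ', s', t', hs, ht, -⟩
    obtain rfl : s' = s := congrArg Prod.fst hs
    obtain rfl : t' = t := congrArg Prod.fst ht
    have hst : s' ≠ t' := fun e => h (by rw [e])
    exact (hμ (slope_eq_of_linePoint_eq hst hs ht).2).symm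

theorem lineGraph_monoCliqueFree {r k : ℕ} (hk : 2 ≤ k) {μ : Fin r → F}
    (hμ : Function.Injective μ) (f : Fin r → F × F × F → F → Fin k) :
    (lineGraph hμ f).MonoCliqueFree (k + 1) := by
  intro i g hg
  have hadj : ∀ p q, p ≠ q → ∃ ℓ, linePoint (μ i) ℓ (g p).1 = g p ∧
      linePoint (μ i) ℓ (g q).1 = g q ∧ f i ℓ (g p).1 ≠ f i ℓ (g q).1 := by
    intro p q hpq
    obtain ⟨ℓ, s, t, hs, ht, h⟩ := hg p q hpq
    obtain rfl : s = (g p).1 := congrArg Prod.fst hs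
    obtain rfl : t = (g q).1 := congrArg Prod.fst ht
    exact ⟨ℓ, hs, ht, h⟩
  have hne : ∀ p q, p ≠ q → (g p).1 ≠ (g q).1 := by
    intro p q hpq h
    obtain ⟨ℓ, -, -, h'⟩ := hadj p q hpq
    exact h' (by rw [h])
  have : Nontrivial (Fin (k + 1)) := Fin.nontrivial_iff_two_le.mpr (by omega)
  obtain ⟨p₁, hp₁⟩ := exists_ne (0 : Fin (k + 1))
  obtain ⟨ℓ, h0, h1, -⟩ := hadj 0 p₁ hp₁.symm
  have hon : ∀ p, linePoint (μ i) ℓ (g p).1 = g p := by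
    intro p
    by_cases hp0 : p = 0
    · rw [hp0, h0]
    by_cases hp1 : p = p₁
    · rw [hp1, h1]
    obtain ⟨ℓ', h1', hp', -⟩ := hadj p₁ p (Ne.symm hp1)
    obtain ⟨ℓ'', h0', hp'', -⟩ := hadj 0 p (Ne.symm hp0)
    rw [line_eq_of_triangle (hne 0 p₁ hp₁.symm) (hne p₁ p (Ne.symm hp1)) (h0.trans h0'.symm)
      (h1.trans h1'.symm) (hp'.trans hp''.symm), hp']
  have hinj : Function.Injective fun p => f i ℓ (g p).1 := by
    intro p q hpq
    by_contra h
    obtain ⟨ℓ', hp, hq, h'⟩ := hadj p q h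
    rw [line_eq_of_two_points (hne p q h) (hp.trans (hon p).symm) (hq.trans (hon q).symm)] at h'
    exact h' hpq
  have := Fintype.card_le_of_injective _ hinj
  simp at this

theorem exists_pattern [Fintype F] {k r : ℕ} (hk : 2 ≤ k) (hr : 0 < r)
    (hrF : r ≤ Fintype.card F) (hF : 4 * k * r * Real.log k ≤ Fintype.card F) :
    ∃ X : ColoredGraph r (F × F × F), X.MonoCliqueFree (k + 1) ∧
      ∀ c : F × F × F → Fin r, ∃ i, ∃ f : Fin k → F × F × F,
        (∀ p, c (f p) = i) ∧ ∀ p q, p ≠ q → X.Adj i (f p) (f q) := by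
  classical
  obtain ⟨μ⟩ : Nonempty (Fin r ↪ F) :=
    Function.Embedding.nonempty_of_card_le (by simpa using hrF)
  choose f hf using fun i : Fin r =>
    exists_line_partition hk hr (linePoint (μ i)) rfl (card_le_card_incident (μ i)) hF
  refine ⟨lineGraph μ.injective f, lineGraph_monoCliqueFree hk μ.injective f, fun c => ?_⟩
  obtain ⟨i, hi⟩ : ∃ i, Fintype.card (F × F × F) ≤
      r * (Finset.univ.filter fun v => c v = i).card := by
    by_contra! h
    have h1 := Finset.card_eq_sum_card_fiberwise (f := c) (s := Finset.univ) (t := Finset.univ)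
      fun _ _ => Finset.mem_coe.mpr (Finset.mem_univ _)
    have h2 : ∑ i : Fin r, r * (Finset.univ.filter fun v => c v = i).card <
        ∑ _i : Fin r, Fintype.card (F × F × F) :=
      Finset.sum_lt_sum_of_nonempty ⟨⟨0, hr⟩, Finset.mem_univ _⟩ fun i _ => h i
    rw [← Finset.mul_sum, ← h1, Finset.sum_const, Finset.card_univ, Finset.card_univ,
      Fintype.card_fin, smul_eq_mul] at h2
    exact lt_irrefl _ h2
  obtain ⟨ℓ, hℓ⟩ := hf i _ hi
  choose t ht htj using hℓ
  refine ⟨i, fun j => linePoint (μ i) ℓ (t j), fun j => (Finset.mem_filter.mp (ht j)).2,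
    fun p q hpq => ⟨ℓ, t p, t q, rfl, rfl, ?_⟩⟩
  rwa [htj, htj]

end Geometry

/-- For all integers `k ≥ 2` and `r ≥ 3`, the smallest minimum degree of an
`r`-Ramsey minimal graph for `K_{k+1}` satisfies
`s_r(K_{k+1}) ≤ (8·k·r·ln k)³`, i.e. there is an `r`-Ramsey minimal graph for
`K_{k+1}` whose minimum degree is at most `(8·k·r·ln k)³`. -/
theorem stmt_0 (k r : ℕ) (hk : 2 ≤ k) (hr : 3 ≤ r) :
    ∃ (n : ℕ) (G : SimpleGraph (Fin n)), IsRamseyMinimal G r (k + 1) ∧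
      (minDeg G : ℝ) ≤ (8 * k * r * Real.log k) ^ 3 := by
  have hk2 : (2 : ℝ) ≤ k := by exact_mod_cast hk
  have hr3 : (3 : ℝ) ≤ r := by exact_mod_cast hr
  have hlog : 1 / 2 ≤ Real.log k :=
    (by linarith [Real.log_two_gt_d9] : 1 / 2 ≤ Real.log 2).trans
      (Real.log_le_log (by norm_num) hk2)
  have hkl : 1 ≤ k * Real.log k := by nlinarith
  have hx : (r : ℝ) ≤ 4 * k * r * Real.log k := by nlinarith
  set M := ⌊4 * k * r * Real.log k⌋₊ with hM
  have hMr : r ≤ M := Nat.le_floor hx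
  obtain ⟨q, hq, hMq, hqM⟩ := Nat.exists_prime_lt_and_le_two_mul M (by omega)
  have : Fact q.Prime := ⟨hq⟩
  obtain ⟨X, hX, hpat⟩ := exists_pattern (F := ZMod q) hk (by omega : 0 < r)
    (by rw [ZMod.card]; omega)
    (by rw [ZMod.card]; exact (Nat.lt_of_floor_lt hMq).le)
  obtain ⟨n, G, hG, hdeg⟩ := exists_isRamseyMinimal_of_pattern (by omega) hk X hX hpat
  refine ⟨n, G, hG, ?_⟩
  have hcard : Fintype.card (ZMod q × ZMod q × ZMod q) = q ^ 3 := by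
    simp only [Fintype.card_prod, ZMod.card]
    ring
  rw [hcard] at hdeg
  have hqx : (q : ℝ) ≤ 8 * k * r * Real.log k := by
    have h1 : (q : ℝ) ≤ 2 * M := by exact_mod_cast hqM
    have h2 : (M : ℝ) ≤ 4 * k * r * Real.log k := Nat.floor_le (by positivity)
    linarith
  calc (minDeg G : ℝ) ≤ (q : ℝ) ^ 3 := by exact_mod_cast hdeg
    _ ≤ (8 * k * r * Real.log k) ^ 3 := by gcongr
end

section
/- Let q be any prime power. There exists a family I_1, …, I_{q−1} of triangle-free partial linear spaces, each of order (q−1, q−2), all on the same point set P = F_q³, with pairwise disjoint line sets L_1, …, L_{q−1}, such that the point-line geometry (P, L_1 ∪ ⋯ ∪ L_{q−1}) is also a partial linear space. -/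
/-- A set of lines (each a set of points) forms a partial linear space:
any two distinct lines meet in at most one point. -/
def IsPLS {P : Type*} (L : Set (Set P)) : Prop :=
  ∀ l₁ ∈ L, ∀ l₂ ∈ L, l₁ ≠ l₂ → (l₁ ∩ l₂).Subsingleton

/-- The partial linear space has order `(s, t)`: every line contains exactly
`s + 1` points and every point lies on exactly `t + 1` lines. -/
def HasOrder {P : Type*} (L : Set (Set P)) (s t : ℕ) : Prop :=
  (∀ l ∈ L, l.ncard = s + 1) ∧ ∀ x : P, {l ∈ L | x ∈ l}.ncard = t + 1

/-- Triangle-free: no three distinct lines pairwise meeting in three distinct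
points. -/
def TriangleFree {P : Type*} (L : Set (Set P)) : Prop :=
  ¬ ∃ l₁ ∈ L, ∃ l₂ ∈ L, ∃ l₃ ∈ L, l₁ ≠ l₂ ∧ l₂ ≠ l₃ ∧ l₁ ≠ l₃ ∧
    ∃ x y z : P, x ≠ y ∧ y ≠ z ∧ x ≠ z ∧
      x ∈ l₁ ∩ l₂ ∧ y ∈ l₂ ∩ l₃ ∧ z ∈ l₃ ∩ l₁

/-- The affine line through `(0, a, b)` with direction `(1, u, v)`. -/
def affLine {F : Type*} [Field F] (u v a b : F) : Set (F × F × F) :=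
  {p | p.2.1 = a + p.1 * u ∧ p.2.2 = b + p.1 * v}

/-- The affine lines whose direction `(1, u, v)` lies on the hyperbola `u * v = c`. -/
def hyperbolaLines {F : Type*} [Field F] (c : F) : Set (Set (F × F × F)) :=
  {l | ∃ u v a b, u * v = c ∧ l = affLine u v a b}

section

variable {F : Type*} [Field F]

theorem fst_ne_of_mem_affLine {u v a b : F} {x y : F × F × F} (hx : x ∈ affLine u v a b)
    (hy : y ∈ affLine u v a b) (hxy : x ≠ y) : x.1 ≠ y.1 := by
  rintro h
  refine hxy (Prod.ext h (Prod.ext ?_ ?_))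
  · rw [hx.1, hy.1, h]
  · rw [hx.2, hy.2, h]

theorem affLine_params_eq {u v a b u' v' a' b' : F} {x y : F × F × F}
    (hx : x ∈ affLine u v a b) (hy : y ∈ affLine u v a b)
    (hx' : x ∈ affLine u' v' a' b') (hy' : y ∈ affLine u' v' a' b') (hxy : x ≠ y) :
    u = u' ∧ v = v' ∧ a = a' ∧ b = b' := by
  have h := sub_ne_zero.2 (fst_ne_of_mem_affLine hx hy hxy)
  obtain ⟨h1, h2⟩ := hx
  obtain ⟨h3, h4⟩ := hy
  obtain ⟨h5, h6⟩ := hx'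
  obtain ⟨h7, h8⟩ := hy'
  have hu : u = u' := mul_left_cancel₀ h (by linear_combination h5 - h1 + h3 - h7)
  have hv : v = v' := mul_left_cancel₀ h (by linear_combination h6 - h2 + h4 - h8)
  subst hu hv
  exact ⟨rfl, rfl, by linear_combination h5 - h1, by linear_combination h6 - h2⟩

theorem affLine_injective {u v a b u' v' a' b' : F}
    (h : affLine u v a b = affLine u' v' a' b') : u = u' ∧ v = v' ∧ a = a' ∧ b = b' := by
  have h0 : ((0, a, b) : F × F × F) ∈ affLine u v a b := by simp [affLine]
  have h1 : ((1, a + u, b + v) : F × F × F) ∈ affLine u v a b := by simp [affLine]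
  exact affLine_params_eq h0 h1 (h ▸ h0) (h ▸ h1) (by simp)

theorem affLine_eq_of_mem {u v a b a' b' : F} {x : F × F × F} (hx : x ∈ affLine u v a b)
    (hx' : x ∈ affLine u v a' b') : affLine u v a b = affLine u v a' b' := by
  rw [show a = a' by linear_combination hx'.1 - hx.1,
    show b = b' by linear_combination hx'.2 - hx.2]

theorem hyperbolaLines_iUnion_isPLS {ι : Type*} (c : ι → F) :
    IsPLS (⋃ i, hyperbolaLines (c i)) := by
  intro l₁ h₁ l₂ h₂ hne x hx y hy
  obtain ⟨i, u, v, a, b, -, rfl⟩ := Set.mem_iUnion.1 h₁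
  obtain ⟨j, u', v', a', b', -, rfl⟩ := Set.mem_iUnion.1 h₂
  by_contra hxy
  obtain ⟨rfl, rfl, rfl, rfl⟩ := affLine_params_eq hx.1 hy.1 hx.2 hy.2 hxy
  exact hne rfl

theorem hyperbolaLines_isPLS (c : F) : IsPLS (hyperbolaLines c) := by
  simpa only [Set.iUnion_const] using hyperbolaLines_iUnion_isPLS (fun _ : Unit => c)

theorem hyperbolaLines_disjoint {c d : F} (h : c ≠ d) :
    Disjoint (hyperbolaLines c) (hyperbolaLines d) := by
  rw [Set.disjoint_left]
  rintro _ ⟨u, v, a, b, rfl, rfl⟩ ⟨u', v', a', b', rfl, h'⟩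
  obtain ⟨rfl, rfl, -, -⟩ := affLine_injective h'
  exact h rfl

theorem affLine_eq_of_mem_of_mul_eq {c u v v' a b a' b' : F} {x : F × F × F} (hc : c ≠ 0)
    (h : u * v = c) (h' : u * v' = c) (hx : x ∈ affLine u v a b)
    (hx' : x ∈ affLine u v' a' b') : affLine u v a b = affLine u v' a' b' := by
  have hu : u ≠ 0 := by rintro rfl; simp [← h] at hc
  obtain rfl : v = v' := mul_left_cancel₀ hu (h.trans h'.symm)
  exact affLine_eq_of_mem hx hx'

theorem hyperbolaLines_triangleFree {c : F} (hc : c ≠ 0) : TriangleFree (hyperbolaLines c) := by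
  rintro ⟨_, ⟨u₁, v₁, a₁, b₁, h₁, rfl⟩, _, ⟨u₂, v₂, a₂, b₂, h₂, rfl⟩,
    _, ⟨u₃, v₃, a₃, b₃, h₃, rfl⟩, h12, h23, h13, x, y, z, hxy, hyz, hxz,
    ⟨hx1, hx2⟩, ⟨hy2, hy3⟩, ⟨hz3, hz1⟩⟩
  have hu12 : u₁ ≠ u₂ := by
    rintro rfl
    exact h12 (affLine_eq_of_mem_of_mul_eq hc h₁ h₂ hx1 hx2)
  have hu13 : u₁ ≠ u₃ := by
    rintro rfl
    exact h13 (affLine_eq_of_mem_of_mul_eq hc h₁ h₃ hz1 hz3)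
  have hA := fst_ne_of_mem_affLine hx1 hz1 hxz
  obtain ⟨p1, p2⟩ := hx1
  obtain ⟨p3, p4⟩ := hx2
  obtain ⟨p5, p6⟩ := hy2
  obtain ⟨p7, p8⟩ := hy3
  obtain ⟨p9, p10⟩ := hz3
  obtain ⟨p11, p12⟩ := hz1
  have hU : x.1 * (u₁ - u₂) + y.1 * (u₂ - u₃) + z.1 * (u₃ - u₁) = 0 := by
    linear_combination p3 - p1 + p7 - p5 + p11 - p9
  have hV : x.1 * (v₁ - v₂) + y.1 * (v₂ - v₃) + z.1 * (v₃ - v₁) = 0 := by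
    linear_combination p4 - p2 + p8 - p6 + p12 - p10
  have hV' : c * (x.1 * (u₂ - u₁) * u₃ + y.1 * (u₃ - u₂) * u₁ + z.1 * (u₁ - u₃) * u₂) = 0 := by
    linear_combination u₁ * u₂ * u₃ * hV - (x.1 - z.1) * u₂ * u₃ * h₁
      - (y.1 - x.1) * u₁ * u₃ * h₂ - (z.1 - y.1) * u₁ * u₂ * h₃
  have hV'' := (mul_eq_zero.1 hV').resolve_left hc
  have key : (x.1 - z.1) * ((u₁ - u₂) * (u₁ - u₃)) = 0 := by
    linear_combination u₁ * hU + hV''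
  exact mul_ne_zero (sub_ne_zero.2 hA)
    (mul_ne_zero (sub_ne_zero.2 hu12) (sub_ne_zero.2 hu13)) key

theorem affLine_ncard (u v a b : F) : (affLine u v a b).ncard = Nat.card F := by
  have : affLine u v a b = Set.range fun t : F => (t, a + t * u, b + t * v) := by
    ext ⟨t, y, z⟩
    simp [affLine, eq_comm]
  rw [this, Set.ncard_range_of_injective]
  intro s t h
  exact congrArg Prod.fst h

theorem hyperbolaLines_ncard_through {c : F} (hc : c ≠ 0) (x : F × F × F) :
    {l ∈ hyperbolaLines c | x ∈ l}.ncard = Nat.card Fˣ := by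
  have : {l ∈ hyperbolaLines c | x ∈ l} = Set.range fun u : Fˣ =>
      affLine (u : F) (c * (u : F)⁻¹) (x.2.1 - x.1 * u) (x.2.2 - x.1 * (c * (u : F)⁻¹)) := by
    ext l
    constructor
    · rintro ⟨⟨u, v, a, b, h, rfl⟩, hx⟩
      have hu : u ≠ 0 := by rintro rfl; simp [← h] at hc
      refine ⟨Units.mk0 u hu, ?_⟩
      have hv : c * u⁻¹ = v := by rw [← h]; field_simp
      simp only [Units.val_mk0, hv]
      rw [hx.1, hx.2, add_sub_cancel_right, add_sub_cancel_right]
    · rintro ⟨u, rfl⟩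
      exact ⟨⟨_, _, _, _, by field_simp, rfl⟩, by simp [affLine]⟩
  rw [this, Set.ncard_range_of_injective]
  intro u w h
  exact Units.ext (affLine_injective h).1

theorem hyperbolaLines_hasOrder [Fintype F] {c : F} (hc : c ≠ 0) :
    HasOrder (hyperbolaLines c) (Fintype.card F - 1) (Fintype.card F - 2) := by
  have hq : 1 < Fintype.card F := Fintype.one_lt_card
  constructor
  · rintro _ ⟨u, v, a, b, -, rfl⟩
    rw [affLine_ncard, Nat.card_eq_fintype_card]
    omega
  · intro x
    rw [hyperbolaLines_ncard_through hc, Nat.card_units, Nat.card_eq_fintype_card]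
    omega

end

/-- For any prime power `q` (i.e. any finite field `F` with `q` elements),
there is a family of `q - 1` triangle-free partial linear spaces of order
`(q - 1, q - 2)` on the common point set `F³`, with pairwise disjoint line
sets, whose union is again a partial linear space. -/
theorem stmt_2 (F : Type*) [Field F] [Fintype F] :
    ∃ L : Fin (Fintype.card F - 1) → Set (Set (F × F × F)),
      (∀ i, IsPLS (L i)) ∧
      (∀ i, TriangleFree (L i)) ∧
      (∀ i, HasOrder (L i) (Fintype.card F - 1) (Fintype.card F - 2)) ∧
      (∀ i j, i ≠ j → Disjoint (L i) (L j)) ∧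
      IsPLS (⋃ i, L i) := by
  classical
  have e : Fin (Fintype.card F - 1) ≃ Fˣ :=
    (Fintype.equivFinOfCardEq (Fintype.card_units F)).symm
  refine ⟨fun i => hyperbolaLines (e i : F), fun i => hyperbolaLines_isPLS _,
    fun i => hyperbolaLines_triangleFree (e i).ne_zero,
    fun i => hyperbolaLines_hasOrder (e i).ne_zero, fun i j hij => hyperbolaLines_disjoint ?_,
    hyperbolaLines_iUnion_isPLS _⟩
  exact fun h => hij (e.injective (Units.ext h))
end

section
/- Let (P, L) be a triangle-free partial linear space of order (s, t), where s, t are positive integers, and suppose |P| = (st + 1)(s + 1). Then for every line ℓ ∈ L and every point x ∈ P not on ℓ, there exists a point y ∈ ℓ such that x and y are collinear; that is, (P, L) is a generalised quadrangle. -/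
section

open Finset Classical

/-- In a partial linear space, the points other than `y` on the lines through `y` other than a
line `l` are counted by the lines they lie on. -/
theorem IsPLS.card_biUnion_lines_through {P : Type*} [Fintype P] {L : Set (Set P)} {s t : ℕ}
    (hpls : IsPLS L) (hord : HasOrder L s t) {l : Set P} (hl : l ∈ L) {y : P} (hy : y ∈ l) :
    (({m ∈ L | y ∈ m} \ {l}).toFinset.biUnion fun m => (m \ {y}).toFinset).card = t * s := by
  rw [card_biUnion]
  · rw [sum_const_nat (m := s)]
    · rw [← Set.ncard_eq_toFinset_card',
        Set.ncard_sdiff_singleton_of_mem (show l ∈ {m ∈ L | y ∈ m} from ⟨hl, hy⟩), hord.2 y,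
        Nat.add_sub_cancel]
    · intro m hm
      simp only [Set.mem_toFinset, Set.mem_sdiff, Set.mem_ofPred_eq] at hm
      rw [← Set.ncard_eq_toFinset_card', Set.ncard_sdiff_singleton_of_mem hm.1.2, hord.1 m hm.1.1,
        Nat.add_sub_cancel]
  · intro m hm n hn hmn
    rw [mem_coe] at hm hn
    simp only [Set.mem_toFinset, Set.mem_sdiff, Set.mem_ofPred_eq] at hm hn
    rw [Function.onFun, Finset.disjoint_left]
    intro z hz hz'
    simp only [Set.mem_toFinset, Set.mem_sdiff, Set.mem_singleton_iff] at hz hz'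
    exact hz.2 (hpls m hm.1.1 n hn.1.1 hmn ⟨hz.1, hz'.1⟩ ⟨hm.1.2, hn.1.2⟩)

/-- A triangle-free partial linear space of order `(s, t)` with exactly
`(st + 1)(s + 1)` points is a generalised quadrangle: for every line `ℓ` and
every point `x` not on `ℓ` there is a point of `ℓ` collinear with `x`. -/
theorem stmt_9 (P : Type*) [Fintype P] (L : Set (Set P)) (s t : ℕ)
    (hs : 1 ≤ s) (ht : 1 ≤ t) (hpls : IsPLS L) (htf : TriangleFree L)
    (hord : HasOrder L s t)
    (hcard : Fintype.card P = (s * t + 1) * (s + 1)) :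
    ∀ l ∈ L, ∀ x : P, x ∉ l → ∃ y ∈ l, ∃ m ∈ L, x ∈ m ∧ y ∈ m := by
  intro l hl x hx
  let A : P → Finset P := fun y =>
    ({m ∈ L | y ∈ m} \ {l}).toFinset.biUnion fun m => (m \ {y}).toFinset
  have mem_A {y z : P} : z ∈ A y ↔ ∃ m ∈ L, y ∈ m ∧ m ≠ l ∧ z ∈ m ∧ z ≠ y := by
    simp [A, and_assoc]
  have notMem_l {y z : P} (hy : y ∈ l) (hz : z ∈ A y) : z ∉ l := by
    obtain ⟨m, hm, hym, hml, hzm, hzy⟩ := mem_A.1 hz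
    exact fun hzl => hzy (hpls m hm l hl hml ⟨hzm, hzl⟩ ⟨hym, hy⟩)
  have card_l : l.toFinset.card = s + 1 := by
    rw [← Set.ncard_eq_toFinset_card', hord.1 l hl]
  have card_A : (l.toFinset.biUnion A).card = (s + 1) * (t * s) := by
    rw [card_biUnion, sum_const_nat (m := t * s), card_l]
    · exact fun y hy => hpls.card_biUnion_lines_through hord hl (Set.mem_toFinset.1 hy)
    · intro y hy y' hy' hne
      rw [mem_coe, Set.mem_toFinset] at hy hy'
      rw [Function.onFun, Finset.disjoint_left]
      intro z hz hz'
      have hzl := notMem_l hy hz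
      obtain ⟨m, hm, hym, hml, hzm, hzy⟩ := mem_A.1 hz
      obtain ⟨n, hn, hyn, hnl, hzn, hzy'⟩ := mem_A.1 hz'
      have hmn : m ≠ n := by
        rintro rfl
        exact hne (hpls m hm l hl hml ⟨hym, hy⟩ ⟨hyn, hy'⟩)
      exact htf ⟨l, hl, m, hm, n, hn, hml.symm, hmn, hnl.symm, y, z, y', hzy.symm, hzy', hne,
        ⟨hy, hym⟩, ⟨hzm, hzn⟩, ⟨hyn, hy'⟩⟩
  have hdisj : Disjoint l.toFinset (l.toFinset.biUnion A) := by
    rw [Finset.disjoint_left]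
    intro z hz hz'
    obtain ⟨y, hy, hzy⟩ := mem_biUnion.1 hz'
    exact notMem_l (Set.mem_toFinset.1 hy) hzy (Set.mem_toFinset.1 hz)
  have hcover : l.toFinset ∪ l.toFinset.biUnion A = univ := by
    rw [← card_eq_iff_eq_univ, card_union_of_disjoint hdisj, card_l, card_A, hcard]
    ring
  obtain hxl | hxA := mem_union.1 (hcover ▸ mem_univ x)
  · exact absurd (Set.mem_toFinset.1 hxl) hx
  · obtain ⟨y, hy, hxy⟩ := mem_biUnion.1 hxA
    obtain ⟨m, hm, hym, -, hxm, -⟩ := mem_A.1 hxy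
    exact ⟨y, Set.mem_toFinset.1 hy, m, hm, hxm, hym⟩

end
end
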